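/- arXiv:1505.06727 — 2 statements merged into one kernel-verified Lean document; each statement's English description precedes it below -/
import Mathlib

section
/- Let X be a Banach space. Suppose there exist a weak*-null biorthogonal system (x_{n,α}, γ_{n,α})_{n∈ω, α∈𝔠} in X and a constant C ≥ 0 such that ‖Σ_{i=1}^k x_{n_i,α_i}‖ ≤ C for all pairwise distinct n_1,…,n_k ∈ ω, all α_1,…,α_k ∈ 𝔠, and all k ≥ 1. Then there exists a twisted sum of c₀ and X that does not split, i.e., Ext(X, c₀) ≠ 0. -/
open Cardinal
open scoped Classical

/-- The Banach space `c₀` of real sequences vanishing at infinity. -/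
abbrev czero : Type := ZeroAtInftyContinuousMap ℕ ℝ

/-- coding -/
def dyA (y : ℝ) (p : ℕ) : Prop := ∃ l : ℕ, p = Encodable.encode (l, ⌊(2:ℝ)^l * y⌋)

theorem dyA_ad (y y' : ℝ) (h : y ≠ y') : {p | dyA y p ∧ dyA y' p}.Finite := by
  have hpos : 0 < |y - y'| := abs_pos.2 (sub_ne_zero.2 h)
  obtain ⟨K, hK⟩ := pow_unbounded_of_one_lt (1 / |y - y'|) (one_lt_two (α := ℝ))
  refine ((Set.finite_lt_nat K).image (fun l => Encodable.encode (l, ⌊(2:ℝ)^l * y⌋))).subset ?_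
  rintro p ⟨⟨l, hl⟩, ⟨l', hl'⟩⟩
  refine ⟨l, ?_, hl.symm⟩
  have := Encodable.encode_injective (hl.symm.trans hl')
  simp only [Prod.mk.injEq] at this
  obtain ⟨rfl, hf⟩ := this
  have h1 := Int.abs_sub_lt_one_of_floor_eq_floor hf
  by_contra hlK
  simp only [Set.mem_ofPred_eq, not_lt] at hlK
  have h2 : (2:ℝ)^K ≤ 2^l := pow_le_pow_right₀ one_le_two hlK
  rw [← mul_sub, abs_mul, abs_of_pos (by positivity : (0:ℝ) < 2^l)] at h1
  rw [div_lt_iff₀ hpos] at hK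
  nlinarith

theorem exists_phi : ∃ (φ : ℝ →+ ℚ) (h : ℝ), (∀ q : ℚ, φ q = q) ∧ h ≠ 0 ∧ ∀ r : ℚ, φ (r * h) = 0 := by
  obtain ⟨f, hf⟩ := LinearMap.exists_leftInverse_of_injective (Algebra.linearMap ℚ ℝ)
    (LinearMap.ker_eq_bot.2 (algebraMap ℚ ℝ).injective)
  have hf' : ∀ q : ℚ, f q = q := fun q => by
    simpa using LinearMap.congr_fun hf q
  refine ⟨f.toAddMonoidHom, √2 - (f (√2) : ℚ), hf', ?_, ?_⟩
  · rw [sub_ne_zero]; exact irrational_sqrt_two.ne_rat _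
  · intro r
    have : (r:ℝ) * (√2 - (f (√2) : ℚ)) = r • (√2 - ((f (√2) : ℚ):ℝ)) := by
      rw [Rat.smul_def]
    show f _ = 0
    rw [this, map_smul, map_sub, hf', sub_self, smul_zero]

theorem comb_step (φ : ℝ →+ ℚ) (h : ℝ) (hφ : ∀ q : ℚ, φ q = q) (h0 : h ≠ 0)
    (hk : ∀ r : ℚ, φ (r * h) = 0) (j : ℝ → ℕ) (n : ℚ) (U : Set ℝ) (hU : IsOpen U)
    (hne : U.Nonempty) :
    ∃ V ⊆ U, IsOpen V ∧ V.Nonempty ∧ ∃ J : ℕ, ∀ W ⊆ V, IsOpen W → W.Nonempty →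
      ∃ y ∈ W, φ y = n ∧ j y ≤ J := by
  let D : ℕ → Set ℝ := fun J => {y | y ∈ U ∧ φ y = n ∧ j y ≤ J}
  let t : ℚ × ℚ → ℝ := fun a => a.1 + a.2 * h
  have hcov : (⋃ a : ℕ × (ℚ × ℚ), (fun z => z - t a.2) ⁻¹' closure (D a.1)) = Set.univ := by
    rw [Set.eq_univ_iff_forall]
    intro z
    rw [Set.mem_iUnion]
    obtain ⟨r, hr⟩ : ∃ r : ℚ, z - ((φ z - n : ℚ):ℝ) - r * h ∈ U := by
      have hc : IsOpen ((fun s : ℝ => z - ((φ z - n : ℚ):ℝ) - s * h) ⁻¹' U) :=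
        hU.preimage (by fun_prop)
      have hn : ((fun s : ℝ => z - ((φ z - n : ℚ):ℝ) - s * h) ⁻¹' U).Nonempty := by
        obtain ⟨u, hu⟩ := hne
        refine ⟨(z - ((φ z - n : ℚ):ℝ) - u) / h, ?_⟩
        simp only [Set.mem_preimage]
        rw [div_mul_cancel₀ _ h0]
        simpa using hu
      obtain ⟨s, hs, ⟨r, rfl⟩⟩ := Rat.denseRange_cast (𝕜 := ℝ) |>.inter_open_nonempty _ hc hn
      exact ⟨r, hs⟩
    have e : z - t (φ z - n, r) = z - ((φ z - n : ℚ):ℝ) - r * h := by simp only [t]; ring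
    refine ⟨(j (z - t (φ z - n, r)), (φ z - n, r)), subset_closure ⟨?_, ?_, le_rfl⟩⟩
    · simpa only [e] using hr
    · simp only [e]
      rw [map_sub, map_sub, hφ, hk]; ring
  obtain ⟨a, ha⟩ := nonempty_interior_of_iUnion_of_closed
    (fun a => isClosed_closure.preimage (by fun_prop)) hcov
  obtain ⟨b, hb⟩ := ha
  have hO : IsOpen (interior (closure (D a.1))) := isOpen_interior
  have hOne : (interior (closure (D a.1))).Nonempty := by
    refine ⟨b - t a.2, ?_⟩
    have := (Homeomorph.subRight (t a.2)).preimage_interior (closure (D a.1))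
    rw [← Homeomorph.coe_subRight, ← this] at hb
    exact hb
  have hsub : ∀ W ⊆ interior (closure (D a.1)), IsOpen W → W.Nonempty → (W ∩ D a.1).Nonempty := by
    intro W hW hWo hWn
    obtain ⟨w, hw⟩ := hWn
    exact mem_closure_iff.1 (interior_subset (hW hw)) W hWo hw
  refine ⟨interior (closure (D a.1)) ∩ U, Set.inter_subset_right, hO.inter hU, ?_, a.1, ?_⟩
  · obtain ⟨w, hw, hw'⟩ := hsub _ subset_rfl hO hOne
    exact ⟨w, hw, hw'.1⟩
  · intro W hW hWo hWn
    obtain ⟨w, hw, hw'⟩ := hsub W (hW.trans Set.inter_subset_left) hWo hWn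
    exact ⟨w, hw, hw'.2⟩

theorem comb_ind (φ : ℝ →+ ℚ) (h : ℝ) (hφ : ∀ q : ℚ, φ q = q) (h0 : h ≠ 0)
    (hk : ∀ r : ℚ, φ (r * h) = 0) (j : ℝ → ℕ) (m : ℕ) :
    ∃ V : Set ℝ, IsOpen V ∧ V.Nonempty ∧ ∃ J : ℕ, ∀ W ⊆ V, IsOpen W → W.Nonempty →
      ∀ n < m, ∃ y ∈ W, φ y = (n : ℚ) ∧ j y ≤ J := by
  induction m with
  | zero => exact ⟨Set.univ, isOpen_univ, Set.univ_nonempty, 0, by simp⟩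
  | succ m ih =>
    obtain ⟨U, hU, hUn, J, hJ⟩ := ih
    obtain ⟨V, hVU, hV, hVn, J', hJ'⟩ := comb_step φ h hφ h0 hk j m U hU hUn
    refine ⟨V, hV, hVn, max J J', ?_⟩
    intro W hW hWo hWn n hn
    rcases Nat.lt_succ_iff_lt_or_eq.1 hn with hn | rfl
    · obtain ⟨y, hy, h1, h2⟩ := hJ W (hW.trans hVU) hWo hWn n hn
      exact ⟨y, hy, h1, h2.trans (le_max_left _ _)⟩
    · obtain ⟨y, hy, h1, h2⟩ := hJ' W hW hWo hWn
      exact ⟨y, hy, h1, h2.trans (le_max_right _ _)⟩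

theorem comb : ∃ N : ℝ → ℕ, ∀ j : ℝ → ℕ, ∀ m : ℕ, ∃ (p : ℕ) (y : ℕ → ℝ), ∀ n < m,
    N (y n) = n ∧ dyA (y n) p ∧ j (y n) ≤ p := by
  obtain ⟨φ, h, hφ, h0, hk⟩ := exists_phi
  refine ⟨fun y => ⌊φ y⌋₊, fun j m => ?_⟩
  obtain ⟨V, hV, ⟨v, hv⟩, J, hJ⟩ := comb_ind φ h hφ h0 hk j m
  obtain ⟨ε, hε, hball⟩ := Metric.isOpen_iff.1 hV v hv
  obtain ⟨K, hK⟩ := pow_unbounded_of_one_lt (1 / ε) (one_lt_two (α := ℝ))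
  obtain ⟨l, hlK, hlJ⟩ : ∃ l, K ≤ l ∧ J ≤ Encodable.encode (l, ⌊(2:ℝ)^l * v⌋) := by
    have hinj : Function.Injective (fun l : ℕ => Encodable.encode (l, ⌊(2:ℝ)^l * v⌋)) := by
      intro a b hab
      have := Encodable.encode_injective hab
      simp only [Prod.mk.injEq] at this
      exact this.1
    have := hinj.nat_tendsto_atTop
    obtain ⟨l, h1, h2⟩ := ((this.eventually_ge_atTop J).and (Filter.eventually_ge_atTop K)).exists
    exact ⟨l, h2, h1⟩
  set k := ⌊(2:ℝ)^l * v⌋ with hkdef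
  have h2l : (0:ℝ) < 2^l := by positivity
  have hbig : 1 / ε < 2^l := hK.trans_le (pow_le_pow_right₀ one_le_two hlK)
  rw [div_lt_iff₀ hε] at hbig
  have hk1 := Int.floor_le ((2:ℝ)^l * v)
  have hk2 := Int.lt_floor_add_one ((2:ℝ)^l * v)
  rw [← hkdef] at hk1 hk2
  have hWV : Set.Ioo ((k:ℝ) / 2^l) ((k+1) / 2^l) ⊆ V := by
    refine Set.Subset.trans ?_ hball
    rintro z ⟨hz1, hz2⟩
    rw [div_lt_iff₀ h2l] at hz1
    rw [lt_div_iff₀ h2l] at hz2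
    rw [Metric.mem_ball, Real.dist_eq, abs_lt]
    constructor <;> nlinarith
  have hall := hJ _ hWV isOpen_Ioo (Set.nonempty_Ioo.2 (by gcongr; linarith))
  choose! y hy1 hy2 hy3 using hall
  refine ⟨Encodable.encode (l, k), y, fun n hn => ⟨?_, ⟨l, ?_⟩, (hy3 n hn).trans hlJ⟩⟩
  · simp [hy2 n hn]
  · congr 2
    obtain ⟨hz1, hz2⟩ := hy1 n hn
    rw [div_lt_iff₀ h2l] at hz1
    rw [lt_div_iff₀ h2l] at hz2
    symm
    rw [Int.floor_eq_iff]
    constructor <;> nlinarith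

section Twist

variable {X : Type} [NormedAddCommGroup X] [NormedSpace ℝ X]

/-- Positive part of the section. -/
noncomputable def Psec (A : ℝ → ℕ → Prop) (g : ℝ → X →L[ℝ] ℝ) (v : X) (p : ℕ) : ℝ :=
  ⨆ y : ℝ, if A y p then max (g y v) 0 else 0

/-- The nonlinear section. -/
noncomputable def Ssec (A : ℝ → ℕ → Prop) (g : ℝ → X →L[ℝ] ℝ) (v : X) (p : ℕ) : ℝ :=
  Psec A g v p - Psec A g (-v) p

theorem term_bound {A : ℝ → ℕ → Prop} {g : ℝ → X →L[ℝ] ℝ} {M : ℝ} (hM : ∀ y, ‖g y‖ ≤ M)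
    (v : X) (p : ℕ) (y : ℝ) : (if A y p then max (g y v) 0 else 0) ≤ M * ‖v‖ := by
  have h1 := (g y).le_of_opNorm_le (hM y) v
  have h2 := (norm_nonneg _).trans h1
  have h3 := (le_abs_self _).trans h1
  split_ifs
  · exact max_le h3 h2
  · exact h2

theorem Psec_bdd {A : ℝ → ℕ → Prop} {g : ℝ → X →L[ℝ] ℝ} {M : ℝ} (hM : ∀ y, ‖g y‖ ≤ M)
    (v : X) (p : ℕ) : BddAbove (Set.range fun y : ℝ => if A y p then max (g y v) 0 else 0) :=
  ⟨M * ‖v‖, by rintro _ ⟨y, rfl⟩; exact term_bound hM v p y⟩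

theorem Psec_nonneg (A : ℝ → ℕ → Prop) (g : ℝ → X →L[ℝ] ℝ)
    (v : X) (p : ℕ) : 0 ≤ Psec A g v p := by
  apply Real.iSup_nonneg
  intro y
  split_ifs
  · exact le_max_right _ _
  · exact le_rfl

theorem Psec_lip {A : ℝ → ℕ → Prop} {g : ℝ → X →L[ℝ] ℝ} {M : ℝ} (hM : ∀ y, ‖g y‖ ≤ M)
    (v w : X) (p : ℕ) : Psec A g v p ≤ Psec A g w p + M * ‖v - w‖ := by
  apply ciSup_le
  intro y
  have h1 := le_ciSup (Psec_bdd (A := A) hM w p) y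
  have h2 := (le_abs_self _).trans ((g y).le_of_opNorm_le (hM y) (v - w))
  have h3 := (norm_nonneg _).trans ((g y).le_of_opNorm_le (hM y) (v - w))
  rw [map_sub] at h2
  have h0 := Psec_nonneg A g w p
  by_cases hA : A y p
  · simp only [hA, if_true] at h1 ⊢
    have h4 := (le_max_left _ _).trans h1
    change g y w ≤ Psec A g w p at h4
    exact max_le (by linarith) (by linarith)
  · simp only [hA, if_false]
    linarith

theorem Ssec_lip {A : ℝ → ℕ → Prop} {g : ℝ → X →L[ℝ] ℝ} {M : ℝ} (hM : ∀ y, ‖g y‖ ≤ M)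
    (v w : X) (p : ℕ) : |Ssec A g v p - Ssec A g w p| ≤ 2 * M * ‖v - w‖ := by
  have h1 := Psec_lip (A := A) hM v w p
  have h2 := Psec_lip (A := A) hM w v p
  have h3 := Psec_lip (A := A) hM (-v) (-w) p
  have h4 := Psec_lip (A := A) hM (-w) (-v) p
  rw [norm_sub_rev] at h2
  rw [neg_sub_neg, norm_sub_rev] at h3
  rw [neg_sub_neg] at h4
  unfold Ssec
  rw [abs_le]
  constructor <;> linarith

theorem Ssec_zero (A : ℝ → ℕ → Prop) (g : ℝ → X →L[ℝ] ℝ) (p : ℕ) : Ssec A g 0 p = 0 := by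
  simp [Ssec]

theorem Ssec_bound {A : ℝ → ℕ → Prop} {g : ℝ → X →L[ℝ] ℝ} {M : ℝ} (hM : ∀ y, ‖g y‖ ≤ M)
    (v : X) (p : ℕ) : |Ssec A g v p| ≤ 2 * M * ‖v‖ := by
  simpa [Ssec_zero] using Ssec_lip (A := A) hM v 0 p

theorem ad_eventually {A : ℝ → ℕ → Prop} (hA : ∀ y y', y ≠ y' → {p | A y p ∧ A y' p}.Finite)
    (F : Finset ℝ) : ∀ᶠ p in Filter.atTop, ∀ y ∈ F, ∀ y' ∈ F, A y p → A y' p → y = y' := by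
  rw [Filter.eventually_all_finset]
  intro y _
  rw [Filter.eventually_all_finset]
  intro y' _
  by_cases h : y = y'
  · simp [h]
  · have := (hA y y' h).eventually_cofinite_notMem
    rw [Nat.cofinite_eq_atTop] at this
    filter_upwards [this] with p hp h1 h2
    exact absurd ⟨h1, h2⟩ hp

theorem Psec_approx {A : ℝ → ℕ → Prop} {g : ℝ → X →L[ℝ] ℝ} {M : ℝ} (hM : ∀ y, ‖g y‖ ≤ M)
    (v : X) {ε : ℝ} (hε : 0 < ε) (F : Finset ℝ) (hF : ∀ y ∉ F, |g y v| ≤ ε) (p : ℕ)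
    (hp : ∀ y ∈ F, ∀ y' ∈ F, A y p → A y' p → y = y') :
    |Psec A g v p - ∑ y ∈ F, (if A y p then max (g y v) 0 else 0)| ≤ ε := by
  by_cases hex : ∃ y ∈ F, A y p
  · obtain ⟨y, hy, hyp⟩ := hex
    rw [Finset.sum_eq_single_of_mem y hy
      (fun b hb hne => if_neg fun h => hne (hp b hb y hy h hyp)), if_pos hyp]
    have h1 : max (g y v) 0 ≤ Psec A g v p := by
      have := le_ciSup (Psec_bdd (A := A) hM v p) y
      simp only [hyp, if_true] at this
      exact this
    have h2 : Psec A g v p ≤ max (g y v) 0 + ε := by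
      apply ciSup_le
      intro z
      have h0 : 0 ≤ max (g y v) 0 := le_max_right _ _
      split_ifs with hz
      · by_cases hzF : z ∈ F
        · rw [hp z hzF y hy hz hyp]; linarith
        · exact max_le (by linarith [(abs_le.1 (hF z hzF)).2]) (by linarith)
      · linarith
    rw [abs_le]; constructor <;> linarith
  · push Not at hex
    rw [Finset.sum_eq_zero (fun y hy => if_neg (hex y hy)), sub_zero,
      abs_of_nonneg (Psec_nonneg _ _ _ _)]
    apply ciSup_le
    intro z
    split_ifs with hz
    · exact max_le (abs_le.1 (hF z fun h => hex z h hz)).2 hε.le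
    · exact hε.le

theorem Ssec_approx {A : ℝ → ℕ → Prop} {g : ℝ → X →L[ℝ] ℝ} {M : ℝ} (hM : ∀ y, ‖g y‖ ≤ M)
    (v : X) {ε : ℝ} (hε : 0 < ε) (F : Finset ℝ) (hF : ∀ y ∉ F, |g y v| ≤ ε) (p : ℕ)
    (hp : ∀ y ∈ F, ∀ y' ∈ F, A y p → A y' p → y = y') :
    |Ssec A g v p - ∑ y ∈ F, (if A y p then g y v else 0)| ≤ 2 * ε := by
  have h1 := Psec_approx hM v hε F hF p hp
  have h2 := Psec_approx hM (-v) hε F (by simpa using hF) p hp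
  have h3 : ∑ y ∈ F, (if A y p then g y v else 0) =
      ∑ y ∈ F, (if A y p then max (g y v) 0 else 0) -
      ∑ y ∈ F, (if A y p then max (g y (-v)) 0 else 0) := by
    rw [← Finset.sum_sub_distrib]
    refine Finset.sum_congr rfl fun y _ => ?_
    split_ifs
    · rw [map_neg]
      rcases le_total (g y v) 0 with h | h
      · rw [max_eq_right h, max_eq_left (by linarith)]; ring
      · rw [max_eq_left h, max_eq_right (by linarith)]; ring
    · simp
  rw [h3, Ssec]
  rw [abs_le] at h1 h2 ⊢
  constructor <;> linarith [h1.1, h1.2, h2.1, h2.2]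

/-- Linearity of the section modulo `c₀`. -/
theorem Ssec_lin {A : ℝ → ℕ → Prop} (hA : ∀ y y', y ≠ y' → {p | A y p ∧ A y' p}.Finite)
    {g : ℝ → X →L[ℝ] ℝ} {M : ℝ} (hM : ∀ y, ‖g y‖ ≤ M)
    (hg : ∀ v : X, ∀ ε : ℝ, 0 < ε → {y | ε ≤ |g y v|}.Finite) (a b : ℝ) (v w : X) :
    Filter.Tendsto (fun p => Ssec A g (a • v + b • w) p - (a * Ssec A g v p + b * Ssec A g w p))
      Filter.atTop (nhds 0) := by
  rw [Metric.tendsto_nhds]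
  intro ε hε
  have hK : 0 < 2 * (1 + |a| + |b|) + 1 := by positivity
  obtain ⟨δ, hδ, hδε⟩ : ∃ δ > 0, (2 * (1 + |a| + |b|) + 1) * δ = ε :=
    ⟨ε / (2 * (1 + |a| + |b|) + 1), by positivity, by field_simp⟩
  let F := (hg v δ hδ).toFinset ∪ (hg w δ hδ).toFinset ∪ (hg (a • v + b • w) δ hδ).toFinset
  filter_upwards [ad_eventually hA F] with p hp
  have e1 := Ssec_approx hM v hδ F (fun y hy => by simp [F] at hy; exact hy.1.le) p hp
  have e2 := Ssec_approx hM w hδ F (fun y hy => by simp [F] at hy; exact hy.2.1.le) p hp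
  have e3 := Ssec_approx hM (a • v + b • w) hδ F
    (fun y hy => by simp [F] at hy; simpa using hy.2.2.le) p hp
  have e4 : ∑ y ∈ F, (if A y p then g y (a • v + b • w) else 0) =
      a * ∑ y ∈ F, (if A y p then g y v else 0) + b * ∑ y ∈ F, (if A y p then g y w else 0) := by
    rw [Finset.mul_sum, Finset.mul_sum, ← Finset.sum_add_distrib]
    refine Finset.sum_congr rfl fun y _ => ?_
    split_ifs <;> simp
  rw [e4] at e3
  set α := ∑ y ∈ F, (if A y p then g y v else 0)
  set β := ∑ y ∈ F, (if A y p then g y w else 0)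
  have e1' := mul_le_mul_of_nonneg_left e1 (abs_nonneg a)
  have e2' := mul_le_mul_of_nonneg_left e2 (abs_nonneg b)
  rw [← abs_mul] at e1' e2'
  rw [Real.dist_eq, sub_zero]
  have : Ssec A g (a • v + b • w) p - (a * Ssec A g v p + b * Ssec A g w p) =
    (Ssec A g (a • v + b • w) p - (a * α + b * β)) - a * (Ssec A g v p - α)
      - b * (Ssec A g w p - β) := by ring
  rw [this]
  have t1 := abs_sub (Ssec A g (a • v + b • w) p - (a * α + b * β) - a * (Ssec A g v p - α))
    (b * (Ssec A g w p - β))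
  have t2 := abs_sub (Ssec A g (a • v + b • w) p - (a * α + b * β)) (a * (Ssec A g v p - α))
  nlinarith

theorem Ssec_single {A : ℝ → ℕ → Prop} {g : ℝ → X →L[ℝ] ℝ} {ξ : ℝ → X}
    (hgx : ∀ y y', g y (ξ y') = if y = y' then (1:ℝ) else 0) (y : ℝ) (p : ℕ) :
    Ssec A g (ξ y) p = if A y p then 1 else 0 := by
  have h1 : Psec A g (-ξ y) p = 0 := by
    unfold Psec
    have : ∀ z, (if A z p then max (g z (-ξ y)) 0 else 0) = 0 := by
      intro z
      rw [map_neg, hgx]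
      split_ifs <;> simp
    simp only [this, ciSup_const]
  have h2 : Psec A g (ξ y) p = if A y p then 1 else 0 := by
    have hb : ∀ z, (if A z p then max (g z (ξ y)) 0 else 0) ≤ if A y p then (1:ℝ) else 0 := by
      intro z
      rw [hgx]
      by_cases hz : z = y
      · subst hz; simp
      · simp only [hz, if_false, max_self, ite_self]; split_ifs <;> simp
    apply le_antisymm
    · exact ciSup_le hb
    · have := le_ciSup (f := fun z => if A z p then max (g z (ξ y)) 0 else 0)
        ⟨_, by rintro _ ⟨z, rfl⟩; exact hb z⟩ y
      change _ ≤ Psec A g (ξ y) p at this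
      simpa [hgx] using this
  rw [Ssec, h1, h2, sub_zero]

/-- The twisted sum as a subspace of `X × ℓ∞`. -/
noncomputable def Zsub (A : ℝ → ℕ → Prop) (hA : ∀ y y', y ≠ y' → {p | A y p ∧ A y' p}.Finite)
    (g : ℝ → X →L[ℝ] ℝ) (M : ℝ) (hM : ∀ y, ‖g y‖ ≤ M)
    (hg : ∀ v : X, ∀ ε : ℝ, 0 < ε → {y | ε ≤ |g y v|}.Finite) :
    Submodule ℝ (X × BoundedContinuousFunction ℕ ℝ) where
  carrier := {u | Filter.Tendsto (fun p => u.2 p - Ssec A g u.1 p) Filter.atTop (nhds 0)}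
  zero_mem' := by simp [Ssec_zero]
  add_mem' := by
    intro u w hu hw
    have := (hu.add hw).sub (Ssec_lin hA hM hg 1 1 u.1 w.1)
    simp only [add_zero, sub_zero, one_smul, one_mul] at this
    refine this.congr fun p => ?_
    simp only [Prod.fst_add, Prod.snd_add, BoundedContinuousFunction.coe_add, Pi.add_apply]
    ring
  smul_mem' := by
    intro c u hu
    have := (hu.const_mul c).sub (Ssec_lin hA hM hg c 0 u.1 0)
    simp only [mul_zero, sub_zero, zero_smul, zero_mul, add_zero] at this
    refine this.congr fun p => ?_
    simp only [Prod.smul_fst, Prod.smul_snd, BoundedContinuousFunction.coe_smul, smul_eq_mul]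
    ring

theorem Zsub_closed (A : ℝ → ℕ → Prop) (hA : ∀ y y', y ≠ y' → {p | A y p ∧ A y' p}.Finite)
    (g : ℝ → X →L[ℝ] ℝ) (M : ℝ) (hM : ∀ y, ‖g y‖ ≤ M)
    (hg : ∀ v : X, ∀ ε : ℝ, 0 < ε → {y | ε ≤ |g y v|}.Finite) :
    IsClosed (Zsub A hA g M hM hg : Set (X × BoundedContinuousFunction ℕ ℝ)) := by
  have hM0 : 0 ≤ M := (norm_nonneg _).trans (hM 0)
  rw [← closure_subset_iff_isClosed]
  intro u hu
  show Filter.Tendsto (fun p => u.2 p - Ssec A g u.1 p) Filter.atTop (nhds 0)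
  rw [Metric.tendsto_nhds]
  intro ε hε
  obtain ⟨δ, hδ, hδε⟩ : ∃ δ > 0, (2 + 2 * M) * δ = ε := ⟨ε / (2 + 2 * M), by positivity, by field_simp⟩
  obtain ⟨w, hw, hd⟩ := Metric.mem_closure_iff.1 hu δ hδ
  change Filter.Tendsto (fun p => w.2 p - Ssec A g w.1 p) Filter.atTop (nhds 0) at hw
  rw [Metric.tendsto_nhds] at hw
  filter_upwards [hw δ hδ] with p hp
  rw [Prod.dist_eq, max_lt_iff] at hd
  have h1 := (BoundedContinuousFunction.dist_coe_le_dist (f := u.2) (g := w.2) p).trans_lt hd.2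
  have h2 := Ssec_lip (A := A) hM u.1 w.1 p
  rw [← dist_eq_norm] at h2
  have h3 : 2 * M * dist u.1 w.1 ≤ 2 * M * δ := by gcongr; exact hd.1.le
  rw [Real.dist_eq] at h1 hp ⊢
  rw [sub_zero] at hp ⊢
  have h2 := h2.trans h3
  rw [abs_lt] at h1 hp ⊢
  rw [abs_le] at h2
  constructor <;> linarith [h1.1, h1.2, hp.1, hp.2, h2.1, h2.2]

/-- The section as a bounded function. -/
noncomputable def SB (A : ℝ → ℕ → Prop) (g : ℝ → X →L[ℝ] ℝ) (M : ℝ) (hM : ∀ y, ‖g y‖ ≤ M)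
    (v : X) : BoundedContinuousFunction ℕ ℝ :=
  BoundedContinuousFunction.ofNormedAddCommGroup (Ssec A g v) continuous_of_discreteTopology
    (2 * M * ‖v‖) (fun p => Ssec_bound hM v p)

theorem SB_apply (A : ℝ → ℕ → Prop) (g : ℝ → X →L[ℝ] ℝ) (M : ℝ) (hM : ∀ y, ‖g y‖ ≤ M)
    (v : X) (p : ℕ) : SB A g M hM v p = Ssec A g v p := rfl

theorem SB_norm (A : ℝ → ℕ → Prop) (g : ℝ → X →L[ℝ] ℝ) (M : ℝ) (hM : ∀ y, ‖g y‖ ≤ M)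
    (v : X) : ‖SB A g M hM v‖ ≤ 2 * M * ‖v‖ := by
  have hM0 : 0 ≤ M := (norm_nonneg _).trans (hM 0)
  exact BoundedContinuousFunction.norm_ofNormedAddCommGroup_le _ (by positivity) _

theorem SB_mem (A : ℝ → ℕ → Prop) (hA : ∀ y y', y ≠ y' → {p | A y p ∧ A y' p}.Finite)
    (g : ℝ → X →L[ℝ] ℝ) (M : ℝ) (hM : ∀ y, ‖g y‖ ≤ M)
    (hg : ∀ v : X, ∀ ε : ℝ, 0 < ε → {y | ε ≤ |g y v|}.Finite) (v : X) :
    (v, SB A g M hM v) ∈ Zsub A hA g M hM hg := by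
  show Filter.Tendsto (fun p => SB A g M hM v p - Ssec A g v p) Filter.atTop (nhds 0)
  simp [SB_apply]

theorem czero_tendsto (f : czero) : Filter.Tendsto f Filter.atTop (nhds 0) := by
  have := f.zero_at_infty'
  rwa [Filter.cocompact_eq_cofinite, Nat.cofinite_eq_atTop] at this

/-- inclusion of `c₀` in the twisted sum, as a linear map. -/
noncomputable def iZlin (A : ℝ → ℕ → Prop) (hA : ∀ y y', y ≠ y' → {p | A y p ∧ A y' p}.Finite)
    (g : ℝ → X →L[ℝ] ℝ) (M : ℝ) (hM : ∀ y, ‖g y‖ ≤ M)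
    (hg : ∀ v : X, ∀ ε : ℝ, 0 < ε → {y | ε ≤ |g y v|}.Finite) :
    czero →ₗ[ℝ] Zsub A hA g M hM hg where
  toFun := fun f => ⟨(0, f.toBCF), by
    show Filter.Tendsto (fun p => f.toBCF p - Ssec A g 0 p) Filter.atTop (nhds 0)
    simpa [Ssec_zero] using czero_tendsto f⟩
  map_add' := fun a b => by
    apply Subtype.ext
    refine Prod.ext (by simp) rfl
  map_smul' := fun a b => by
    apply Subtype.ext
    refine Prod.ext (by simp) rfl

/-- inclusion of `c₀` in the twisted sum. -/
noncomputable def iZ (A : ℝ → ℕ → Prop) (hA : ∀ y y', y ≠ y' → {p | A y p ∧ A y' p}.Finite)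
    (g : ℝ → X →L[ℝ] ℝ) (M : ℝ) (hM : ∀ y, ‖g y‖ ≤ M)
    (hg : ∀ v : X, ∀ ε : ℝ, 0 < ε → {y | ε ≤ |g y v|}.Finite) :
    czero →L[ℝ] Zsub A hA g M hM hg :=
  ⟨iZlin A hA g M hM hg, Continuous.subtype_mk
    (continuous_const.prodMk ZeroAtInftyContinuousMap.isometry_toBCF.continuous) _⟩

theorem twist [CompleteSpace X] {A : ℝ → ℕ → Prop}
    (hA : ∀ y y', y ≠ y' → {p | A y p ∧ A y' p}.Finite)
    {g : ℝ → X →L[ℝ] ℝ} {ξ : ℝ → X}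
    (hgx : ∀ y y', g y (ξ y') = if y = y' then (1:ℝ) else 0)
    (hg : ∀ v : X, ∀ ε : ℝ, 0 < ε → {y | ε ≤ |g y v|}.Finite)
    (N : ℝ → ℕ) (hN : ∀ j : ℝ → ℕ, ∀ m : ℕ, ∃ (p : ℕ) (y : ℕ → ℝ), ∀ n < m,
      N (y n) = n ∧ A (y n) p ∧ j (y n) ≤ p)
    (C : ℝ) (hsum : ∀ (m : ℕ) (y : ℕ → ℝ), (∀ n < m, N (y n) = n) →
      ‖∑ n ∈ Finset.range m, ξ (y n)‖ ≤ C) :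
    ∃ (Z : Type) (_ : NormedAddCommGroup Z) (_ : NormedSpace ℝ Z) (_ : CompleteSpace Z)
      (i : czero →L[ℝ] Z) (q : Z →L[ℝ] X),
      Function.Injective i ∧ Function.Surjective q ∧
      (∀ z : Z, q z = 0 ↔ z ∈ Set.range i) ∧
      ¬ ∃ r : Z →L[ℝ] czero, r.comp i = ContinuousLinearMap.id ℝ czero := by
  obtain ⟨M, hM⟩ := banach_steinhaus (g := g) (fun v => by
    obtain ⟨B, hB⟩ := ((hg v 1 one_pos).image fun y => |g y v|).bddAbove
    refine ⟨max B 1, fun y => ?_⟩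
    by_cases hy : 1 ≤ |g y v|
    · exact le_max_of_le_left (hB ⟨y, hy, rfl⟩)
    · exact le_max_of_le_right (le_of_not_ge hy))
  have hM0 : 0 ≤ M := (norm_nonneg _).trans (hM 0)
  let Z := Zsub A hA g M hM hg
  let i : czero →L[ℝ] Z := iZ A hA g M hM hg
  let q : Z →L[ℝ] X := (ContinuousLinearMap.fst ℝ X _).comp Z.subtypeL
  have hker : ∀ z : Z, q z = 0 → ∃ f : czero, i f = z := by
    rintro ⟨⟨v, z⟩, hz⟩ hq
    change v = 0 at hq
    subst hq
    have hz' : Filter.Tendsto (fun p => z p - Ssec A g 0 p) Filter.atTop (nhds 0) := hz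
    simp only [Ssec_zero, sub_zero] at hz'
    refine ⟨⟨z.toContinuousMap, ?_⟩, ?_⟩
    · rw [Filter.cocompact_eq_cofinite, Nat.cofinite_eq_atTop]
      exact hz'
    · apply Subtype.ext
      refine Prod.ext rfl ?_
      ext p; rfl
  refine ⟨Z, inferInstance, inferInstance, ?_, i, q, ?_, ?_, ?_, ?_⟩
  · exact (Zsub_closed A hA g M hM hg).completeSpace_coe
  · intro a b hab
    apply ZeroAtInftyContinuousMap.toBCF_injective
    exact congrArg (fun z : Z => z.1.2) hab
  · intro v
    exact ⟨⟨_, SB_mem A hA g M hM hg v⟩, rfl⟩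
  · intro z
    constructor
    · exact hker z
    · rintro ⟨f, rfl⟩
      rfl
  · rintro ⟨r, hr⟩
    have hri : ∀ f, r (i f) = f := fun f => by simpa using DFunLike.congr_fun hr f
    let σ : X → Z := fun v => ⟨_, SB_mem A hA g M hM hg v⟩
    -- the lifting, evaluated at a coordinate
    let ρ : ℕ → Z →ₗ[ℝ] ℝ := fun p =>
      { toFun := fun z => z.1.2 p - r z p
        map_add' := fun a b => by simp; ring
        map_smul' := fun c a => by simp; ring }
    have hρ : ∀ p z, ρ p z = z.1.2 p - r z p := fun _ _ => rfl
    have hρi : ∀ p f, ρ p (i f) = 0 := fun p f => by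
      rw [hρ, hri]; exact sub_self _
    have hρq : ∀ p z z', q z = q z' → ρ p z = ρ p z' := by
      intro p z z' h
      obtain ⟨f, hf⟩ := hker (z - z') ((q.map_sub z z').trans (sub_eq_zero.2 h))
      rw [← sub_eq_zero, ← map_sub, ← hf, hρi]
    have hev : ∀ (f : czero) p, |f p| ≤ ‖f‖ := fun f p => by
      rw [← ZeroAtInftyContinuousMap.norm_toBCF_eq_norm]
      exact f.toBCF.norm_coe_le_norm p
    have hbd : ∀ p v, ρ p (σ v) ≤ (2 * M + ‖r‖ * (1 + 2 * M)) * ‖v‖ := by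
      intro p v
      have h1 := (le_abs_self _).trans (Ssec_bound (A := A) hM v p)
      have h2 : ‖σ v‖ ≤ (1 + 2 * M) * ‖v‖ := by
        show ‖(v, SB A g M hM v)‖ ≤ _
        rw [Prod.norm_def]
        have := SB_norm A g M hM v
        have := norm_nonneg v
        have : 0 ≤ M * ‖v‖ := by positivity
        apply max_le <;> simp only <;> nlinarith
      have h3 := (neg_le_abs _).trans ((hev (r (σ v)) p).trans (r.le_opNorm_of_le h2))
      rw [hρ]
      change Ssec A g v p - r (σ v) p ≤ _
      linarith
    have hj : ∀ y : ℝ, ∃ j : ℕ, ∀ p ≥ j, r (σ (ξ y)) p < 1 / 2 := fun y => by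
      have := (czero_tendsto (r (σ (ξ y)))).eventually (gt_mem_nhds (show (0:ℝ) < 1/2 by norm_num))
      exact Filter.eventually_atTop.1 this
    choose j hj using hj
    set K := (2 * M + ‖r‖ * (1 + 2 * M)) with hKdef
    have hK0 : 0 ≤ K := by positivity
    obtain ⟨m, hm⟩ := exists_nat_gt (2 * (K * C))
    obtain ⟨p, y, hy⟩ := hN j m
    have hw := hsum m y (fun n hn => (hy n hn).1)
    have e1 : ρ p (σ (∑ n ∈ Finset.range m, ξ (y n))) = ∑ n ∈ Finset.range m, ρ p (σ (ξ (y n))) := by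
      rw [← map_sum]
      apply hρq
      rw [map_sum]
      rfl
    have e2 : ∑ n ∈ Finset.range m, (1/2 : ℝ) ≤ ∑ n ∈ Finset.range m, ρ p (σ (ξ (y n))) := by
      apply Finset.sum_le_sum
      intro n hn
      obtain ⟨_, h1, h2⟩ := hy n (Finset.mem_range.1 hn)
      have h3 := hj (y n) p h2
      rw [hρ]
      change _ ≤ Ssec A g (ξ (y n)) p - _
      rw [Ssec_single hgx, if_pos h1]
      linarith
    have e3 := hbd p (∑ n ∈ Finset.range m, ξ (y n))
    have e4 := e3.trans (mul_le_mul_of_nonneg_left hw hK0)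
    rw [e1] at e4
    rw [Finset.sum_const, Finset.card_range, nsmul_eq_mul] at e2
    linarith

end Twist

/-- If a Banach space `X` admits a weak*-null biorthogonal system
`(x_{n,α}, γ_{n,α})_{n∈ω, α∈𝔠}` with uniformly bounded finite sums of the `x_{n,α}`
over pairwise distinct `n`'s, then there is a twisted sum of `c₀` and `X` that does not
split, i.e. `Ext(X, c₀) ≠ 0`. -/

theorem statement4 (X : Type) [NormedAddCommGroup X] [NormedSpace ℝ X] [CompleteSpace X]
    (ι : Type) (hι : #ι = Cardinal.continuum)
    (x : ℕ → ι → X) (γ : ℕ → ι → (X →L[ℝ] ℝ))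
    (hbiorth : ∀ n α m β, γ n α (x m β) = if (n, α) = (m, β) then (1 : ℝ) else 0)
    (hwstarnull : ∀ v : X, ∀ ε : ℝ, 0 < ε → {p : ℕ × ι | ε ≤ |γ p.1 p.2 v|}.Finite)
    (C : ℝ) (hC : 0 ≤ C)
    (hsum : ∀ s : Finset (ℕ × ι), s.Nonempty → Set.InjOn Prod.fst (s : Set (ℕ × ι)) →
      ‖∑ p ∈ s, x p.1 p.2‖ ≤ C) :
    ∃ (Z : Type) (_ : NormedAddCommGroup Z) (_ : NormedSpace ℝ Z) (_ : CompleteSpace Z)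
      (i : czero →L[ℝ] Z) (q : Z →L[ℝ] X),
      Function.Injective i ∧ Function.Surjective q ∧
      (∀ z : Z, q z = 0 ↔ z ∈ Set.range i) ∧
      ¬ ∃ r : Z →L[ℝ] czero, r.comp i = ContinuousLinearMap.id ℝ czero := by
  obtain ⟨e⟩ : Nonempty (ℝ ≃ ι) := by
    rw [← Cardinal.eq, hι, Cardinal.mk_real]
  obtain ⟨N, hN⟩ := comb
  refine twist (A := dyA) dyA_ad (g := fun y => γ (N y) (e y)) (ξ := fun y => x (N y) (e y))
    ?_ ?_ N hN C ?_
  · intro y y'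
    simp only [hbiorth, Prod.mk.injEq, EmbeddingLike.apply_eq_iff_eq]
    congr 1
    apply propext
    constructor
    · exact fun h => h.2
    · rintro rfl; exact ⟨rfl, rfl⟩
  · intro v ε hε
    refine Set.Finite.of_injOn (f := fun y => (N y, e y)) (fun y hy => hy) ?_ (hwstarnull v ε hε)
    intro a _ b _ hab
    exact e.injective (Prod.ext_iff.1 hab).2
  · intro m y hy
    rcases Nat.eq_zero_or_pos m with rfl | hm
    · simpa using hC
    have hinj : Set.InjOn (fun n => (N (y n), e (y n))) (Finset.range m : Set ℕ) := by
      intro a ha b hb hab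
      have := (Prod.ext_iff.1 hab).1
      simp only [hy a (by simpa using ha), hy b (by simpa using hb)] at this
      exact this
    have := hsum ((Finset.range m).image fun n => (N (y n), e (y n)))
      ⟨_, Finset.mem_image_of_mem _ (Finset.mem_range.2 hm)⟩ (by
        intro a ha b hb hab
        simp only [Finset.coe_image, Set.mem_image, Finset.coe_range, Set.mem_Iio] at ha hb
        obtain ⟨k, hk, rfl⟩ := ha
        obtain ⟨l, hl, rfl⟩ := hb
        simp only [hy k hk, hy l hl] at hab
        rw [hab])
    rwa [Finset.sum_image hinj] at this
end

section
/- Let K be a compact Hausdorff space. If there exists a bounded weak*-null biorthogonal system (f_{n,α}, γ_{n,α})_{n∈ω, α∈𝔠} in C(K) such that f_{n,α} · f_{m,β} = 0 pointwise for all n ≠ m and all α, β ∈ 𝔠, then Ext(C(K), c₀) ≠ 0. -/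
open Cardinal
open scoped Classical

open Filter Topology BoundedContinuousFunction

namespace ExtHelper

noncomputable def L (p : ℕ) : List ℕ := Denumerable.ofNat (List ℕ) p

def A {ι : Type} (e : ι ≃ (ℕ → ℕ)) (s : ℕ × ι) : Set ℕ :=
  {p | L p = (List.range (L p).length).map (e s.2) ∧ e s.2 (L p).length = s.1}

lemma A_ad {ι : Type} (e : ι ≃ (ℕ → ℕ)) (s s' : ℕ × ι) (h : s ≠ s') :
    {p | p ∈ A e s ∧ p ∈ A e s'}.Finite := by
  by_cases hα : s.2 = s'.2
  · convert Set.finite_empty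
    ext p
    simp only [A, Set.mem_ofPred_eq, Set.mem_empty_iff_false, iff_false]
    rintro ⟨⟨_, h1⟩, ⟨_, h2⟩⟩
    rw [← hα] at h2
    exact h (Prod.ext (h1.symm.trans h2) hα)
  · have hne : e s.2 ≠ e s'.2 := fun hh => hα (e.injective hh)
    obtain ⟨m, hm⟩ := Function.ne_iff.1 hne
    refine ((Set.finite_Iic m).image
      (fun k => Encodable.encode ((List.range k).map (e s.2)))).subset ?_
    rintro p ⟨⟨h1, _⟩, ⟨h2, _⟩⟩
    refine ⟨(L p).length, ?_, ?_⟩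
    · by_contra hlt
      simp only [Set.mem_Iic, not_le] at hlt
      have h2 := h1.symm.trans h2
      have h3 := List.map_inj_left.1 h2 m (by simpa using hlt)
      exact hm h3
    · simp only
      rw [← h1]
      exact Denumerable.encode_ofNat p

lemma A_big {ι : Type} (e : ι ≃ (ℕ → ℕ)) (B : ℕ × ι → Set ℕ) (hB : ∀ s, (B s).Finite) (k : ℕ) :
    ∃ p, ∀ n < k, ∃ α, p ∈ A e (n, α) ∧ p ∉ B (n, α) := by
  let X : ℕ → Set (ℕ → ℕ) := fun j => {x | ∀ n < k, ∀ p ∈ B (n, e.symm x), (L p).length < j}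
  have hX : ∀ x, ∃ j, x ∈ X j := by
    intro x
    have hfin : (⋃ n ∈ Set.Iio k, B (n, e.symm x)).Finite :=
      (Set.finite_Iio k).biUnion (fun n _ => hB _)
    obtain ⟨j, hj⟩ := (hfin.image (fun p => (L p).length)).bddAbove
    refine ⟨j + 1, fun n hn p hp => Nat.lt_succ_of_le (hj ⟨p, ?_, rfl⟩)⟩
    simp only [Set.mem_iUnion]
    exact ⟨n, hn, hp⟩
  obtain ⟨j, x0, hx0⟩ := nonempty_interior_of_iUnion_of_closed (X := ℕ → ℕ)
    (f := fun j => closure (X j)) (fun j => isClosed_closure) (by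
      rw [Set.eq_univ_iff_forall]
      intro x
      obtain ⟨j, hj⟩ := hX x
      exact Set.mem_iUnion.2 ⟨j, subset_closure hj⟩)
  obtain ⟨v, ⟨y0, m, rfl⟩, hxv, hv⟩ :=
    (PiNat.isTopologicalBasis_cylinders (fun _ : ℕ => ℕ)).exists_subset_of_mem_open hx0
      isOpen_interior
  set M := max m j with hM
  have hLp : L (Encodable.encode ((List.range M).map x0)) = (List.range M).map x0 :=
    Denumerable.ofNat_encode _
  refine ⟨Encodable.encode ((List.range M).map x0), fun n hn => ?_⟩
  let y : ℕ → ℕ := Function.update x0 M n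
  have hy : y ∈ closure (X j) := by
    refine interior_subset (hv ?_)
    intro i hi
    have : i ≠ M := by omega
    simp only [y, Function.update_of_ne this]
    exact hxv i hi
  obtain ⟨x, hxc, hxX⟩ := mem_closure_iff.1 hy (PiNat.cylinder y (M+1))
    (PiNat.isOpen_cylinder _ y (M+1)) (PiNat.self_mem_cylinder y (M+1))
  refine ⟨e.symm x, ⟨?_, ?_⟩, ?_⟩
  · rw [hLp]
    simp only [List.length_map, List.length_range, Equiv.apply_symm_apply]
    refine List.map_inj_left.2 fun i hi => ?_
    have hi' : i < M := by simpa using hi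
    rw [hxc i (by omega)]
    simp only [y, Function.update_of_ne hi'.ne]
  · rw [hLp]
    simp only [List.length_map, List.length_range, Equiv.apply_symm_apply]
    rw [hxc M (by omega)]
    simp [y]
  · intro hp
    have := hxX n hn _ hp
    rw [hLp] at this
    simp only [List.length_map, List.length_range] at this
    omega

section
variable {X : Type} [NormedAddCommGroup X] [NormedSpace ℝ X] {S : Type}
  (A : S → Set ℕ) (g : S → (X →L[ℝ] ℝ))

def Zsub : Submodule ℝ ((ℕ →ᵇ ℝ) × X) where
  carrier := {z | (∀ s, ∀ ε : ℝ, 0 < ε → ∀ᶠ p in cofinite, p ∈ A s → |z.1 p - g s z.2| ≤ ε) ∧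
    ∀ ε : ℝ, 0 < ε → ∃ F : Finset S, ∀ᶠ p in cofinite, (∀ s ∈ F, p ∉ A s) → |z.1 p| ≤ ε}
  zero_mem' := by
    refine ⟨fun s ε hε => Eventually.of_forall fun p _ => ?_,
      fun ε hε => ⟨∅, Eventually.of_forall fun p _ => ?_⟩⟩
    · simpa using hε.le
    · simpa using hε.le
  add_mem' := by
    rintro ⟨y, u⟩ ⟨y', u'⟩ ⟨h1, h2⟩ ⟨h1', h2'⟩
    refine ⟨fun s ε hε => ?_, fun ε hε => ?_⟩
    · filter_upwards [h1 s (ε/2) (half_pos hε), h1' s (ε/2) (half_pos hε)] with p hp hp' hA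
      have a := abs_le.1 (hp hA)
      have b := abs_le.1 (hp' hA)
      simp only [Prod.mk_add_mk, BoundedContinuousFunction.coe_add, Pi.add_apply, map_add] at *
      rw [abs_le]; constructor <;> linarith [a.1, a.2, b.1, b.2]
    · obtain ⟨F, hF⟩ := h2 (ε/2) (half_pos hε)
      obtain ⟨F', hF'⟩ := h2' (ε/2) (half_pos hε)
      refine ⟨F ∪ F', ?_⟩
      filter_upwards [hF, hF'] with p hp hp' hA
      have a := abs_le.1 (hp fun s hs => hA s (Finset.mem_union_left _ hs))
      have b := abs_le.1 (hp' fun s hs => hA s (Finset.mem_union_right _ hs))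
      simp only [Prod.mk_add_mk, BoundedContinuousFunction.coe_add, Pi.add_apply] at *
      rw [abs_le]; constructor <;> linarith [a.1, a.2, b.1, b.2]
  smul_mem' := by
    rintro c ⟨y, u⟩ ⟨h1, h2⟩
    have key : ∀ ε : ℝ, 0 < ε → ∀ t : ℝ, |t| ≤ ε / (|c| + 1) → |c * t| ≤ ε := by
      intro ε hε t ht
      rw [le_div_iff₀ (by positivity)] at ht
      rw [abs_mul]
      nlinarith [abs_nonneg t, abs_nonneg c]
    refine ⟨fun s ε hε => ?_, fun ε hε => ?_⟩
    · filter_upwards [h1 s (ε/(|c|+1)) (by positivity)] with p hp hA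
      have := key ε hε _ (hp hA)
      simpa [mul_sub] using this
    · obtain ⟨F, hF⟩ := h2 (ε/(|c|+1)) (by positivity)
      refine ⟨F, ?_⟩
      filter_upwards [hF] with p hp hA
      have := key ε hε _ (hp hA)
      simpa using this

lemma Zsub_closed : IsClosed (Zsub A g : Set ((ℕ →ᵇ ℝ) × X)) := by
  rw [← isSeqClosed_iff_isClosed]
  intro w z hw hz
  have hz1 : Tendsto (fun n => ‖(w n).1 - z.1‖) atTop (𝓝 0) :=
    tendsto_iff_norm_sub_tendsto_zero.1 ((continuous_fst.tendsto z).comp hz)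
  have hpt : ∀ n p, |(w n).1 p - z.1 p| ≤ ‖(w n).1 - z.1‖ := fun n p => by
    simpa using BoundedContinuousFunction.norm_coe_le_norm ((w n).1 - z.1) p
  refine ⟨fun s ε hε => ?_, fun ε hε => ?_⟩
  · have hz2 : Tendsto (fun n => g s (w n).2) atTop (𝓝 (g s z.2)) :=
      (((g s).continuous.comp continuous_snd).tendsto z).comp hz
    obtain ⟨n, hn1, hn2⟩ := ((hz1.eventually (gt_mem_nhds (show (0:ℝ) < ε/3 by linarith))).and
      (Metric.tendsto_nhds.1 hz2 (ε/3) (by linarith))).exists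
    filter_upwards [(hw n).1 s (ε/3) (by linarith)] with p hp hA
    have a := abs_le.1 (hp hA)
    have b := abs_le.1 ((hpt n p).trans hn1.le)
    rw [Real.dist_eq] at hn2
    have c := abs_le.1 hn2.le
    rw [abs_le]; constructor <;> linarith [a.1, a.2, b.1, b.2, c.1, c.2]
  · obtain ⟨n, hn1⟩ := (hz1.eventually (gt_mem_nhds (show (0:ℝ) < ε/2 by linarith))).exists
    obtain ⟨F, hF⟩ := (hw n).2 (ε/2) (by linarith)
    refine ⟨F, ?_⟩
    filter_upwards [hF] with p hp hA
    have a := abs_le.1 (hp hA)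
    have b := abs_le.1 ((hpt n p).trans hn1.le)
    rw [abs_le]; constructor <;> linarith [a.1, a.2, b.1, b.2]

lemma Zsub_ker (y : ℕ →ᵇ ℝ) : (y, (0 : X)) ∈ Zsub A g ↔ Tendsto y cofinite (𝓝 0) := by
  constructor
  · rintro ⟨h1, h2⟩
    rw [Metric.tendsto_nhds]
    intro ε hε
    obtain ⟨F, hF⟩ := h2 (ε/2) (half_pos hε)
    have h3 : ∀ᶠ p in cofinite, ∀ s ∈ F, p ∈ A s → |y p - g s 0| ≤ ε/2 :=
      (Filter.eventually_all_finset F).2 fun s _ => h1 s (ε/2) (half_pos hε)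
    filter_upwards [hF, h3] with p hp hp'
    rw [Real.dist_eq, sub_zero]
    by_cases h : ∀ s ∈ F, p ∉ A s
    · have : |y p| ≤ ε / 2 := hp h
      linarith
    · push Not at h
      obtain ⟨s, hs, hps⟩ := h
      have := hp' s hs hps
      rw [map_zero, sub_zero] at this
      linarith
  · intro h
    rw [Metric.tendsto_nhds] at h
    refine ⟨fun s ε hε => ?_, fun ε hε => ⟨∅, ?_⟩⟩
    · filter_upwards [h ε hε] with p hp _
      simpa [Real.dist_eq] using hp.le
    · filter_upwards [h ε hε] with p hp _
      simpa [Real.dist_eq] using hp.le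

lemma exists_val (hnull : ∀ u : X, ∀ ε : ℝ, 0 < ε → {s | ε ≤ |g s u|}.Finite) (u : X) (p : ℕ) :
    ∃ t : ℝ, (t = 0 ∨ ∃ s, p ∈ A s ∧ t = g s u) ∧ ∀ s, p ∈ A s → |g s u| ≤ |t| := by
  by_cases h : ∃ s, p ∈ A s ∧ 0 < |g s u|
  · obtain ⟨s, hs, hpos⟩ := h
    obtain ⟨s1, ⟨h1, h1'⟩, hmax⟩ := Set.exists_max_image
      ({s' | |g s u| ≤ |g s' u|} ∩ {s' | p ∈ A s'}) (fun s' => |g s' u|)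
      ((hnull u _ hpos).inter_of_left _) ⟨s, le_refl (|g s u|), hs⟩
    refine ⟨g s1 u, Or.inr ⟨s1, h1', rfl⟩, fun s' hs' => ?_⟩
    by_cases hle : |g s u| ≤ |g s' u|
    · exact hmax s' ⟨hle, hs'⟩
    · exact (not_le.1 hle).le.trans h1
  · push Not at h
    exact ⟨0, Or.inl rfl, fun s hs => by simpa using h s hs⟩

lemma exists_lift (hA : ∀ s s', s ≠ s' → {p | p ∈ A s ∧ p ∈ A s'}.Finite)
    (hnull : ∀ u : X, ∀ ε : ℝ, 0 < ε → {s | ε ≤ |g s u|}.Finite)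
    {C : ℝ} (hC : 0 ≤ C) (hg : ∀ s, ‖g s‖ ≤ C) (u : X) : ∃ y : ℕ →ᵇ ℝ, (y, u) ∈ Zsub A g ∧ ‖y‖ ≤ C * ‖u‖ := by
  choose t ht1 ht2 using exists_val A g hnull u
  have hb : ∀ p, ‖t p‖ ≤ C * ‖u‖ := by
    intro p
    rcases ht1 p with h | ⟨s, _, h⟩
    · rw [h]; simpa using mul_nonneg hC (norm_nonneg u)
    · rw [h]; exact (g s).le_of_opNorm_le (hg s) u
  refine ⟨BoundedContinuousFunction.ofNormedAddCommGroupDiscrete t (C * ‖u‖) hb, ⟨?_, ?_⟩, ?_⟩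
  · intro s ε hε
    have hfin := hnull u (ε/2) (half_pos hε)
    have hev : ∀ᶠ p in cofinite, ∀ s' ∈ hfin.toFinset, s ≠ s' → ¬ (p ∈ A s ∧ p ∈ A s') := by
      refine (Filter.eventually_all_finset _).2 fun s' _ => ?_
      by_cases hss : s = s'
      · exact Eventually.of_forall fun p h => absurd hss h
      · filter_upwards [(hA s s' hss).compl_mem_cofinite] with p hp _ using hp
    filter_upwards [hev] with p hp hps
    change |t p - g s u| ≤ ε
    have h2 := ht2 p s hps
    by_cases hlt : |t p| < ε / 2
    · have a := abs_lt.1 hlt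
      have b := abs_lt.1 (h2.trans_lt hlt)
      rw [abs_le]; constructor <;> linarith [a.1, a.2, b.1, b.2]
    · rw [not_lt] at hlt
      rcases ht1 p with h | ⟨s', hs', h⟩
      · rw [h, abs_zero] at hlt; linarith
      · have : s = s' := by
          by_contra hne
          exact hp s' (by simpa [h] using hlt) hne ⟨hps, hs'⟩
        subst this
        rw [h, sub_self, abs_zero]; exact hε.le
  · intro ε hε
    have hfin := hnull u ε hε
    refine ⟨hfin.toFinset, Eventually.of_forall fun p hp => ?_⟩
    change |t p| ≤ ε
    rcases ht1 p with h | ⟨s', hs', h⟩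
    · rw [h, abs_zero]; exact hε.le
    · by_contra hlt
      exact hp s' (by simpa [h] using (not_le.1 hlt).le) hs'
  · exact (BoundedContinuousFunction.norm_le (mul_nonneg hC (norm_nonneg u))).2 hb

noncomputable def chi (B : Set ℕ) : ℕ →ᵇ ℝ :=
  BoundedContinuousFunction.ofNormedAddCommGroupDiscrete (B.indicator 1) 1 (fun p => by
    by_cases h : p ∈ B <;> simp [h])

lemma chi_mem (hA : ∀ s s', s ≠ s' → {p | p ∈ A s ∧ p ∈ A s'}.Finite)
    (s : S) (u : X) (hu : g s u = 1) (hu' : ∀ s', s' ≠ s → g s' u = 0) :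
    (chi (A s), u) ∈ Zsub A g := by
  refine ⟨fun s' ε hε => ?_, fun ε hε => ⟨{s}, Eventually.of_forall fun p hp => ?_⟩⟩
  · by_cases hss : s' = s
    · subst hss
      refine Eventually.of_forall fun p hp => ?_
      change |(A s').indicator 1 p - g s' u| ≤ ε
      simp [hp, hu, hε.le]
    · filter_upwards [(hA s' s hss).compl_mem_cofinite] with p hp hps
      have : p ∉ A s := fun h => hp ⟨hps, h⟩
      change |(A s).indicator 1 p - g s' u| ≤ ε
      simp [this, hu' s' hss, hε.le]
  · have : p ∉ A s := hp s (by simp)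
    change |(A s).indicator (1 : ℕ → ℝ) p| ≤ ε
    simp [this, hε.le]

end

end ExtHelper

open ExtHelper

/-- If `C(K)` admits a bounded weak*-null biorthogonal system
`(f_{n,α}, γ_{n,α})_{n∈ω,α∈𝔠}` with `f_{n,α} · f_{m,β} = 0` whenever `n ≠ m`,
then `Ext(C(K), c₀) ≠ 0`. -/
theorem statement5 (K : Type) [TopologicalSpace K] [CompactSpace K] [T2Space K]
    (ι : Type) (hι : #ι = Cardinal.continuum)
    (f : ℕ → ι → C(K, ℝ)) (γ : ℕ → ι → (C(K, ℝ) →L[ℝ] ℝ))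
    (hbiorth : ∀ n α m β, γ n α (f m β) = if (n, α) = (m, β) then (1 : ℝ) else 0)
    (hbddf : ∃ C : ℝ, ∀ n α, ‖f n α‖ ≤ C) (hbddγ : ∃ C : ℝ, ∀ n α, ‖γ n α‖ ≤ C)
    (hwstarnull : ∀ g : C(K, ℝ), ∀ ε : ℝ, 0 < ε → {p : ℕ × ι | ε ≤ |γ p.1 p.2 g|}.Finite)
    (hdisj : ∀ n α m β, n ≠ m → ∀ t : K, f n α t * f m β t = 0) :
    ∃ (Z : Type) (_ : NormedAddCommGroup Z) (_ : NormedSpace ℝ Z) (_ : CompleteSpace Z)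
      (i : czero →L[ℝ] Z) (q : Z →L[ℝ] C(K, ℝ)),
      Function.Injective i ∧ Function.Surjective q ∧
      (∀ z : Z, q z = 0 ↔ z ∈ Set.range i) ∧
      ¬ ∃ r : Z →L[ℝ] czero, r.comp i = ContinuousLinearMap.id ℝ czero := by
  obtain ⟨Cf, hCf⟩ := hbddf
  obtain ⟨Cγ, hCγ⟩ := hbddγ
  have hcard : #ι = #(ℕ → ℕ) := by rw [hι]; simp
  obtain ⟨e⟩ := Cardinal.eq.1 hcard
  set D := max Cγ 1 with hD
  have hD0 : 0 ≤ D := le_trans zero_le_one (le_max_right _ _)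
  let g : ℕ × ι → (C(K, ℝ) →L[ℝ] ℝ) := fun s => γ s.1 s.2
  have hgD : ∀ s, ‖g s‖ ≤ D := fun s => (hCγ s.1 s.2).trans (le_max_left _ _)
  have hAD := A_ad e
  have hlift := exists_lift (A e) g hAD hwstarnull hD0 hgD
  have hcl := Zsub_closed (A e) g
  have h0 : ∀ c : czero, Filter.Tendsto c Filter.cofinite (nhds 0) := fun c => by
    have := c.zero_at_infty'
    rw [Filter.cocompact_eq_cofinite] at this
    exact this
  let i0 : czero →ₗ[ℝ] (Zsub (A e) g) :=
    { toFun := fun c => ⟨(c.toBCF, 0), (Zsub_ker (A e) g c.toBCF).2 (h0 c)⟩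
      map_add' := fun c c' => by
        apply Subtype.ext
        refine Prod.ext ?_ (by simp)
        ext p; rfl
      map_smul' := fun a c => by
        apply Subtype.ext
        refine Prod.ext ?_ (by simp)
        ext p; rfl }
  let i : czero →L[ℝ] (Zsub (A e) g) := ⟨i0, by
    refine Continuous.subtype_mk (Continuous.prodMk ?_ continuous_const) _
    exact ZeroAtInftyContinuousMap.isometry_toBCF.continuous⟩
  let q : (Zsub (A e) g) →L[ℝ] C(K, ℝ) :=
    (ContinuousLinearMap.snd ℝ (BoundedContinuousFunction ℕ ℝ) C(K, ℝ)).comp (Zsub (A e) g).subtypeL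
  have hi : ∀ (c : czero) p, (i c).1.1 p = c p := fun c p => rfl
  have hker : ∀ z : Zsub (A e) g, q z = 0 ↔ z ∈ Set.range i := by
    rintro ⟨⟨y, u⟩, hz⟩
    constructor
    · intro h
      change u = 0 at h
      subst h
      have ht := (Zsub_ker (A e) g y).1 hz
      refine ⟨⟨y.toContinuousMap, by rw [Filter.cocompact_eq_cofinite]; exact ht⟩, ?_⟩
      rfl
    · rintro ⟨c, hc⟩
      rw [← hc]; rfl
  refine ⟨Zsub (A e) g, inferInstance, inferInstance, hcl.completeSpace_coe, i, q, ?_, ?_, hker, ?_⟩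
  · intro c c' h
    ext p
    rw [← hi, ← hi, h]
  · intro u
    obtain ⟨y, hy, _⟩ := hlift u
    exact ⟨⟨(y, u), hy⟩, rfl⟩
  · rintro ⟨r, hr⟩
    have hri : ∀ c, r (i c) = c := fun c => by
      have := congrArg (fun T : czero →L[ℝ] czero => T c) hr
      simpa using this
    have hzm : ∀ s : ℕ × ι, (chi (A e s), f s.1 s.2) ∈ Zsub (A e) g := fun s => by
      refine chi_mem (A e) g hAD s _ ?_ ?_
      · simp [g, hbiorth]
      · intro s' hs'
        simp only [g, hbiorth]
        exact if_neg hs'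
    let z : ℕ × ι → Zsub (A e) g := fun s => ⟨_, hzm s⟩
    -- the key bound
    have hbound : ∀ (w : Zsub (A e) g) p, |w.1.1 p - r w p| ≤ (1 + ‖r‖) * (D * ‖q w‖) := by
      intro w p
      obtain ⟨y, hy, hyn⟩ := hlift (q w)
      let w' : Zsub (A e) g := ⟨(y, q w), hy⟩
      obtain ⟨c, hc⟩ := (hker (w - w')).1 (by exact sub_self (q w))
      have hw : w = w' + i c := by rw [hc]; abel
      have e1 : w.1.1 p - r w p = y p - r w' p := by
        have a1 : w.1.1 p = y p + c p := by
          conv_lhs => rw [hw]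
          rfl
        have a2 : r w p = r w' p + c p := by
          conv_lhs => rw [hw, map_add, hri]
          rfl
        rw [a1, a2]; ring
      have hw'n : ‖w'‖ ≤ D * ‖q w‖ := by
        change ‖((y, q w) : (BoundedContinuousFunction ℕ ℝ) × C(K, ℝ))‖ ≤ _
        rw [Prod.norm_mk]
        exact max_le hyn (le_mul_of_one_le_left (norm_nonneg _) (le_max_right _ _))
      have b1 : |y p| ≤ D * ‖q w‖ := (y.norm_coe_le_norm p).trans hyn
      have b2 : |r w' p| ≤ ‖r‖ * (D * ‖q w‖) := by
        have c1 : |r w' p| ≤ ‖r w'‖ := by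
          rw [← ZeroAtInftyContinuousMap.norm_toBCF_eq_norm]
          exact (r w').toBCF.norm_coe_le_norm p
        exact c1.trans ((r.le_opNorm w').trans (by gcongr))
      rw [e1]
      have := abs_sub (y p) (r w' p)
      linarith
    have hBfin : ∀ s, {p | (1:ℝ)/2 ≤ |r (z s) p|}.Finite := fun s => by
      have := Metric.tendsto_nhds.1 (h0 (r (z s))) (1/2) (by norm_num)
      rw [Filter.eventually_cofinite] at this
      refine this.subset fun p hp => ?_
      simpa [Real.dist_eq] using hp
    obtain ⟨k, hk⟩ := exists_nat_gt (2 * ((1 + ‖r‖) * (D * Cf)))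
    obtain ⟨p, hp⟩ := A_big e (fun s => {p | (1:ℝ)/2 ≤ |r (z s) p|}) hBfin k
    have hne : Nonempty ι := ⟨e.symm 0⟩
    have hp2 : ∀ n, ∃ α, n < k → p ∈ A e (n, α) ∧ ¬ ((1:ℝ)/2 ≤ |r (z (n, α)) p|) := fun n => by
      by_cases hn : n < k
      · obtain ⟨α, h⟩ := hp n hn
        exact ⟨α, fun _ => h⟩
      · exact ⟨hne.some, fun h => absurd h hn⟩
    choose a ha using hp2
    let ev : Zsub (A e) g →ₗ[ℝ] ℝ :=
      { toFun := fun w => w.1.1 p - r w p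
        map_add' := fun w w' => by
          rw [map_add]
          change (w.1.1 p + w'.1.1 p) - (r w p + r w' p) = _
          ring
        map_smul' := fun c w => by
          rw [map_smul]
          change (c * w.1.1 p) - (c * r w p) = c * (w.1.1 p - r w p)
          ring }
    have hev : ∀ n ∈ Finset.range k, (1:ℝ)/2 ≤ ev (z (n, a n)) := by
      intro n hn
      obtain ⟨h1, h2⟩ := ha n (Finset.mem_range.1 hn)
      change (1:ℝ)/2 ≤ (A e (n, a n)).indicator 1 p - r (z (n, a n)) p
      rw [Set.indicator_of_mem h1, Pi.one_apply]
      have := (abs_lt.1 (not_le.1 h2)).2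
      linarith
    have hsum : (k:ℝ) * (1/2) ≤ ev (∑ n ∈ Finset.range k, z (n, a n)) := by
      rw [map_sum]
      simpa using Finset.card_nsmul_le_sum _ _ _ hev
    have hCf0 : 0 ≤ Cf := (norm_nonneg _).trans (hCf 0 hne.some)
    have hq : ‖q (∑ n ∈ Finset.range k, z (n, a n))‖ ≤ Cf := by
      rw [map_sum]
      change ‖∑ n ∈ Finset.range k, f n (a n)‖ ≤ Cf
      rw [ContinuousMap.norm_le _ hCf0]
      intro t
      rw [ContinuousMap.sum_apply]
      by_cases hz : ∃ n ∈ Finset.range k, f n (a n) t ≠ 0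
      · obtain ⟨n, hn, hnt⟩ := hz
        rw [Finset.sum_eq_single_of_mem n hn]
        · exact ((f n (a n)).norm_coe_le_norm t).trans (hCf _ _)
        · intro m _ hmn
          exact (mul_eq_zero.1 (hdisj m (a m) n (a n) hmn t)).resolve_right hnt
      · push Not at hz
        rw [Finset.sum_eq_zero hz, norm_zero]
        exact hCf0
    have hfin := (le_abs_self _).trans (hbound (∑ n ∈ Finset.range k, z (n, a n)) p)
    have hfin2 : (1 + ‖r‖) * (D * ‖q (∑ n ∈ Finset.range k, z (n, a n))‖)
        ≤ (1 + ‖r‖) * (D * Cf) := by gcongr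
    have hfin3 : ev (∑ n ∈ Finset.range k, z (n, a n)) ≤ (1 + ‖r‖) * (D * Cf) := hfin.trans hfin2
    linarith
end
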